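/- Let X be a compact Hausdorff space, A a semisimple commutative unital Banach algebra, and 𝑨 an admissible A-valued uniform algebra on X with 𝔄 = 𝑨 ∩ C(X), such that every character of 𝑨 is of the form ψ⋄φ with ψ ∈ Φ(𝔄), φ ∈ Φ(A). Suppose 𝔄 admits bounded relative units. Then 𝑨 is strongly regular if and only if A is strongly regular. -/

import Mathlib

open WeakDual Topology

namespace VV

variable (B : Type*) [NormedCommRing B] [NormedAlgebra ℂ B]

/-- The ideal `I_ψ = {b | ψ b = 0}`. -/
def Iid (ψ : characterSpace ℂ B) : Set B := {b : B | ψ b = 0}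

/-- The ideal `J_ψ` of elements whose Gelfand transform vanishes on a
neighbourhood of `ψ`. -/
def Jid (ψ : characterSpace ℂ B) : Set B :=
  {b : B | ∃ U ∈ nhds ψ, ∀ χ ∈ U, χ b = 0}

/-- Regularity of a commutative Banach algebra. -/
def IsRegular : Prop :=
  ∀ E : Set (characterSpace ℂ B), IsClosed E →
    ∀ ψ₀ ∉ E, ∃ b : B, ψ₀ b ≠ 0 ∧ ∀ ψ ∈ E, ψ b = 0

def IsStronglyRegularAt (ψ : characterSpace ℂ B) : Prop :=
  Iid B ψ ⊆ closure (Jid B ψ)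

def IsStronglyRegular : Prop := ∀ ψ : characterSpace ℂ B, IsStronglyRegularAt B ψ

/-- Bounded relative units at a character. -/
def HasBRUAt (ψ : characterSpace ℂ B) : Prop :=
  ∃ M : ℝ, 0 < M ∧ ∀ K : Set (characterSpace ℂ B), IsCompact K → ψ ∉ K →
    ∃ b ∈ Jid B ψ, (∀ χ ∈ K, χ b = 1) ∧ ‖b‖ ≤ M

def HasBRU : Prop := ∀ ψ : characterSpace ℂ B, HasBRUAt B ψ

/-- Ditkin's condition at a character: `b ∈ closure (b • J_ψ)` for every `b ∈ I_ψ`. -/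
def DitkinAt (ψ : characterSpace ℂ B) : Prop :=
  ∀ b ∈ Iid B ψ, b ∈ closure ((fun u => b * u) '' Jid B ψ)

def IsDitkin : Prop := ∀ ψ : characterSpace ℂ B, DitkinAt B ψ

/-- `I` has a bounded approximate identity contained in `J`: a bounded net `(u_i)`
in `J` with `‖b * u_i - b‖ → 0` for every `b ∈ I`. -/
def HasBAI (I J : Set B) : Prop :=
  ∃ (ι : Type) (le : ι → ι → Prop) (u : ι → B) (M : ℝ),
    Nonempty ι ∧ (∀ i j : ι, ∃ k, le i k ∧ le j k) ∧
    (∀ i, u i ∈ J) ∧ (∀ i, ‖u i‖ ≤ M) ∧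
    ∀ b ∈ I, ∀ ε : ℝ, 0 < ε → ∃ i, ∀ j, le i j → ‖b * u j - b‖ < ε

/-- Strong Ditkin's condition at `ψ`. -/
def StrongDitkinAt (ψ : characterSpace ℂ B) : Prop := HasBAI B (Iid B ψ) (Jid B ψ)

def IsStrongDitkin : Prop := ∀ ψ : characterSpace ℂ B, StrongDitkinAt B ψ

/-- Normality. -/
def IsNormal : Prop :=
  ∀ E : Set (characterSpace ℂ B), IsClosed E → E ≠ Set.univ →
    ∀ F : Set (characterSpace ℂ B), IsCompact F → (∀ ψ ∈ F, ψ ∉ E) →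
      ∃ b : B, (∀ ψ ∈ F, ψ b = 1) ∧ ∀ ψ ∈ E, ψ b = 0

/-- Semisimplicity: the Gelfand transform is injective. -/
def IsSemisimple : Prop :=
  ∀ b : B, (∀ ψ : characterSpace ℂ B, ψ b = 0) → b = 0



variable (X : Type*) [TopologicalSpace X] [CompactSpace X] [T2Space X]
variable (A : Type*) [NormedCommRing A] [NormedAlgebra ℂ A] [CompleteSpace A] [Nontrivial A]

section FunctionAlgebra

variable (B : Type*) [NormedCommRing B] [NormedAlgebra ℂ B] [CompleteSpace B] [Nontrivial B]

/-- `𝑨` contains the constant functions. -/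
def ContainsConstants (ι : B →ₐ[ℂ] C(X, A)) : Prop :=
  ∀ a : A, ∃ b : B, ∀ x : X, ι b x = a

/-- `𝑨` separates the points of `X`. -/
def Separates (ι : B →ₐ[ℂ] C(X, A)) : Prop :=
  ∀ x y : X, x ≠ y → ∃ b : B, ι b x ≠ ι b y

/-- Admissibility: `φ ∘ f ∈ 𝑨` whenever `f ∈ 𝑨` and `φ ∈ Φ(A)`. -/
def Admissible (ι : B →ₐ[ℂ] C(X, A)) : Prop :=
  ∀ (f : B) (φ : characterSpace ℂ A), ∃ g : B,
    ∀ x : X, ι g x = algebraMap ℂ A (φ (ι f x))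

/-- The subalgebra `𝔄 = 𝑨 ∩ C(X)` of scalar-valued members of `𝑨`. -/
def scalarSub (ι : B →ₐ[ℂ] C(X, A)) : Subalgebra ℂ B where
  carrier := {b : B | ∀ x : X, ∃ c : ℂ, ι b x = algebraMap ℂ A c}
  mul_mem' := by
    intro b b' hb hb' x
    obtain ⟨c, hc⟩ := hb x
    obtain ⟨c', hc'⟩ := hb' x
    refine ⟨c * c', ?_⟩
    rw [map_mul, ContinuousMap.mul_apply, hc, hc', map_mul]
  add_mem' := by
    intro b b' hb hb' x
    obtain ⟨c, hc⟩ := hb x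
    obtain ⟨c', hc'⟩ := hb' x
    refine ⟨c + c', ?_⟩
    rw [map_add, ContinuousMap.add_apply, hc, hc', map_add]
  algebraMap_mem' := by
    intro r x
    refine ⟨r, ?_⟩
    rw [AlgHom.commutes]
    simp [Algebra.algebraMap_eq_smul_one]

/-- `𝑨` is an `A`-valued uniform algebra: its norm is equivalent to the sup norm. -/
def IsUniform (ι : B →ₐ[ℂ] C(X, A)) : Prop :=
  ∃ c C : ℝ, 0 < c ∧ ∀ b : B, c * ‖ι b‖ ≤ ‖b‖ ∧ ‖b‖ ≤ C * ‖ι b‖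

/-- Every character of `𝑨` is of the form `ψ ⋄ φ`. -/
def NaturalProduct (ι : B →ₐ[ℂ] C(X, A)) : Prop :=
  ∀ τ : characterSpace ℂ B,
    ∃ (ψ : characterSpace ℂ (scalarSub X A B ι)) (φ : characterSpace ℂ A),
      ∀ (f : B) (g : scalarSub X A B ι),
        (∀ x : X, ι (g : B) x = algebraMap ℂ A (φ (ι f x))) → τ f = ψ g

end FunctionAlgebra

end VV

namespace VV

section Pullback

variable {P Q : Type*} [NormedCommRing P] [NormedAlgebra ℂ P]
  [NormedCommRing Q] [NormedAlgebra ℂ Q]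

/-- Pullback of characters along a continuous algebra homomorphism. -/
noncomputable def pullback (h : P →ₐ[ℂ] Q) (hc : Continuous h) (χ : characterSpace ℂ Q) :
    characterSpace ℂ P :=
  ⟨StrongDual.toWeakDual
      ((WeakDual.toStrongDual (χ : WeakDual ℂ Q)).comp ⟨h.toLinearMap, hc⟩), by
    rw [CharacterSpace.eq_set_map_one_map_mul]
    exact ⟨(congrArg χ (map_one h)).trans (map_one χ),
      fun a b => (congrArg χ (map_mul h a b)).trans (map_mul χ _ _)⟩⟩

@[simp]
theorem pullback_apply (h : P →ₐ[ℂ] Q) (hc : Continuous h) (χ : characterSpace ℂ Q) (p : P) :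
    pullback h hc χ p = χ (h p) := rfl

theorem continuous_apply_characterSpace (q : Q) : Continuous fun χ : characterSpace ℂ Q => χ q :=
  (WeakDual.eval_continuous q).comp continuous_subtype_val

theorem continuous_to_characterSpace {Y : Type*} [TopologicalSpace Y]
    {F : Y → characterSpace ℂ P} (hF : ∀ p, Continuous fun y => F y p) : Continuous F :=
  Continuous.subtype_mk (WeakDual.continuous_of_continuous_eval hF) _

theorem continuous_pullback (h : P →ₐ[ℂ] Q) (hc : Continuous h) : Continuous (pullback h hc) :=
  continuous_to_characterSpace fun p => continuous_apply_characterSpace (h p)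

/-- Homomorphisms map the ideals `J` of pulled back characters into the ideals `J`. -/
theorem map_mem_Jid (h : P →ₐ[ℂ] Q) (hc : Continuous h) {χ : characterSpace ℂ Q} {p : P}
    (hp : p ∈ Jid P (pullback h hc χ)) : h p ∈ Jid Q χ := by
  obtain ⟨U, hU, hz⟩ := hp
  exact ⟨_, (continuous_pullback h hc).continuousAt.preimage_mem_nhds hU, fun η hη => hz _ hη⟩

theorem apply_eq_zero_of_mem_Jid {χ : characterSpace ℂ Q} {q : Q} (hq : q ∈ Jid Q χ) :
    χ q = 0 := by
  obtain ⟨U, hU, hz⟩ := hq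
  exact hz _ (mem_of_mem_nhds hU)

theorem add_mul_mem_Jid {χ : characterSpace ℂ Q} {p q : Q} (hp : p ∈ Jid Q χ)
    (hq : q ∈ Jid Q χ) (r : Q) : p + q * r ∈ Jid Q χ := by
  obtain ⟨U, hU, hz⟩ := hp
  obtain ⟨V, hV, hw⟩ := hq
  refine ⟨U ∩ V, Filter.inter_mem hU hV, fun η hη => ?_⟩
  rw [map_add, map_mul, hz η hη.1, hw η hη.2, zero_mul, add_zero]

theorem apply_algebraMap (φ : characterSpace ℂ Q) (c : ℂ) : φ (algebraMap ℂ Q c) = c :=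
  AlgHomClass.commutes φ c

end Pullback

section VectorValued

variable {X : Type*} [TopologicalSpace X]
  {A : Type*} [NormedCommRing A] [NormedAlgebra ℂ A]
  {B : Type*} [NormedCommRing B] [NormedAlgebra ℂ B]
  {ι : B →ₐ[ℂ] C(X, A)}

theorem nonempty_of_injective [Nontrivial B] (hinj : Function.Injective ι) : Nonempty X := by
  by_contra hX
  rw [not_nonempty_iff] at hX
  exact one_ne_zero (hinj (by ext x; exact isEmptyElim x) : (1 : B) = 0)

theorem scalar_apply_eq (φ : characterSpace ℂ A) (g : scalarSub X A B ι) (x : X) :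
    ι (g : B) x = algebraMap ℂ A (φ (ι (g : B) x)) := by
  obtain ⟨c, hc⟩ := g.2 x
  rw [hc, apply_algebraMap]

/-- Point evaluation `f ↦ f x` as an algebra homomorphism into `A`. -/
def evalHom (ι : B →ₐ[ℂ] C(X, A)) (x : X) : B →ₐ[ℂ] A :=
  (ContinuousMap.evalAlgHom ℂ A x).comp ι

@[simp]
theorem evalHom_apply (ι : B →ₐ[ℂ] C(X, A)) (x : X) (b : B) : evalHom ι x b = ι b x := rfl

theorem continuous_evalHom (hι : Continuous ι) (x : X) :
    Continuous (evalHom ι x) :=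
  (continuous_eval_const x).comp hι

/-- The evaluation character of the scalar subalgebra at `x`, obtained through any `φ ∈ Φ(A)`. -/
noncomputable def scalarEval (hι : Continuous ι) (φ : characterSpace ℂ A) (x : X) :
    characterSpace ℂ (scalarSub X A B ι) :=
  pullback ((evalHom ι x).comp (scalarSub X A B ι).val)
    ((continuous_evalHom hι x).comp continuous_subtype_val) φ

theorem scalarEval_apply (hι : Continuous ι) (φ : characterSpace ℂ A) (x : X)
    (g : scalarSub X A B ι) : scalarEval hι φ x g = φ (ι (g : B) x) := rfl

theorem continuous_scalarEval (hι : Continuous ι) (φ : characterSpace ℂ A) :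
    Continuous (scalarEval (X := X) hι φ) :=
  continuous_to_characterSpace fun g => (map_continuous φ).comp (ι (g : B)).continuous

theorem scalarEval_injective (hss : IsSemisimple A) (hsep : Separates X A B ι)
    (hadm : Admissible X A B ι) (hι : Continuous ι) (φ : characterSpace ℂ A) :
    Function.Injective (scalarEval (X := X) hι φ) := by
  intro x y hxy
  by_contra hne
  obtain ⟨f, hf⟩ := hsep x y hne
  refine hf (sub_eq_zero.1 (hss _ fun φ' => ?_))
  obtain ⟨g, hg⟩ := hadm f φ'
  have h := congrArg (fun χ => χ (⟨g, fun z => ⟨_, hg z⟩⟩ : scalarSub X A B ι)) hxy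
  simp only [scalarEval_apply, hg, apply_algebraMap] at h
  rw [map_sub, h, sub_self]

variable [CompactSpace X]

theorem IsUniform.continuous (hunif : IsUniform X A B ι) : Continuous ι := by
  obtain ⟨c, C, hc, h⟩ := hunif
  refine AddMonoidHomClass.continuous_of_bound ι c⁻¹ fun b => ?_
  rw [inv_mul_eq_div, le_div_iff₀ hc, mul_comm]
  exact (h b).1

/-- The embedding of `A` as the constant functions. -/
theorem exists_constHom (hinj : Function.Injective ι)
    (hconst : ContainsConstants X A B ι) (hunif : IsUniform X A B ι) :
    ∃ k : A →ₐ[ℂ] B, Continuous k ∧ ∀ a x, ι (k a) x = a := by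
  choose k hk using hconst
  let K : A →ₐ[ℂ] B :=
    { toFun := k
      map_one' := hinj (by ext x; simp [hk])
      map_mul' := fun a b => hinj (by ext x; simp [hk])
      map_zero' := hinj (by ext x; simp [hk])
      map_add' := fun a b => hinj (by ext x; simp [hk])
      commutes' := fun r => hinj (by ext x; rw [hk, AlgHom.commutes]; rfl) }
  refine ⟨K, ?_, hk⟩
  obtain ⟨c, C, -, h⟩ := hunif
  refine AddMonoidHomClass.continuous_of_bound K |C| fun a => ?_
  refine (h (k a)).2.trans ((mul_le_mul_of_nonneg_right (le_abs_self C) (norm_nonneg _)).trans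
    (mul_le_mul_of_nonneg_left ?_ (abs_nonneg C)))
  exact (ContinuousMap.norm_le _ (norm_nonneg a)).2 fun x => (hk a x).symm ▸ le_rfl

/-- A scalar uniform algebra with bounded relative units is natural. -/
theorem scalarEval_surjective (hinj : Function.Injective ι) (hι : Continuous ι)
    (hbru : HasBRU (scalarSub X A B ι)) (φ : characterSpace ℂ A) :
    Function.Surjective (scalarEval (X := X) hι φ) := by
  intro ψ
  by_contra hψ
  obtain ⟨M, -, hM⟩ := hbru ψ
  obtain ⟨b, hb, h1, -⟩ := hM _ (isCompact_range (continuous_scalarEval hι φ)) hψ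
  have hb1 : b = 1 := Subtype.ext (hinj (by
    ext x
    have h := h1 _ ⟨x, rfl⟩
    rw [scalarEval_apply] at h
    rw [scalar_apply_eq φ b x, h]
    simp))
  have h0 := apply_eq_zero_of_mem_Jid hb
  rw [hb1, map_one] at h0
  exact one_ne_zero h0

/-- Every character of the vector-valued algebra has the form `f ↦ φ (f x)`. -/
theorem exists_eval_of_natural (hinj : Function.Injective ι)
    (hadm : Admissible X A B ι) (hnat : NaturalProduct X A B ι) (hι : Continuous ι)
    (hbru : HasBRU (scalarSub X A B ι)) (τ : characterSpace ℂ B) :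
    ∃ (x : X) (φ : characterSpace ℂ A), ∀ f, τ f = φ (ι f x) := by
  obtain ⟨ψ, φ, h⟩ := hnat τ
  obtain ⟨x, rfl⟩ := scalarEval_surjective hinj hι hbru φ ψ
  refine ⟨x, φ, fun f => ?_⟩
  obtain ⟨g, hg⟩ := hadm f φ
  rw [h f ⟨g, fun z => ⟨_, hg z⟩⟩ hg, scalarEval_apply]
  simp only [hg, apply_algebraMap]

/-- Strong regularity passes from a vector-valued algebra to its algebra of values. -/
theorem IsStronglyRegular.of_vectorValued [Nontrivial B] (hinj : Function.Injective ι)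
    (hconst : ContainsConstants X A B ι) (hunif : IsUniform X A B ι)
    (hB : IsStronglyRegular B) : IsStronglyRegular A := by
  intro φ a ha
  obtain ⟨x⟩ := nonempty_of_injective hinj
  have hx := continuous_evalHom hunif.continuous x
  obtain ⟨f, hf⟩ := hconst a
  have hmem : f ∈ Iid B (pullback (evalHom ι x) hx φ) := by
    simpa [Iid, hf] using ha
  have hcl := image_closure_subset_closure_image hx (Set.mem_image_of_mem _ (hB _ hmem))
  rw [evalHom_apply, hf] at hcl
  refine closure_mono ?_ hcl
  rintro _ ⟨g, ⟨U, hU, hz⟩, rfl⟩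
  exact ⟨_, (continuous_pullback (evalHom ι x) hx).continuousAt.preimage_mem_nhds hU,
    fun η hη => hz _ hη⟩

/-- Strong regularity passes from the algebra of values to the vector-valued algebra. -/
theorem IsStronglyRegular.vectorValued (hss : IsSemisimple A) (hinj : Function.Injective ι)
    (hconst : ContainsConstants X A B ι) (hsep : Separates X A B ι)
    (hadm : Admissible X A B ι) (hnat : NaturalProduct X A B ι) (hunif : IsUniform X A B ι)
    (hbru : HasBRU (scalarSub X A B ι)) (hA : IsStronglyRegular A) :
    IsStronglyRegular B := by
  intro τ f hf
  have hι := hunif.continuous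
  obtain ⟨k, hk, hkι⟩ := exists_constHom hinj hconst hunif
  obtain ⟨x, φ, hτ⟩ := exists_eval_of_natural hinj hadm hnat hι hbru τ
  have hτk : pullback k hk τ = φ := Subtype.ext (ContinuousLinearMap.ext fun a => by
    exact (hτ (k a)).trans (by rw [hkι]; rfl))
  have hτs : pullback (scalarSub X A B ι).val continuous_subtype_val τ = scalarEval hι φ x :=
    Subtype.ext (ContinuousLinearMap.ext fun g => hτ g)
  obtain ⟨M, hM0, hM⟩ := hbru (scalarEval hι φ x)
  obtain ⟨c, C, hc, hcC⟩ := hunif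
  set D : ℝ := ‖(1 : A)‖ + M / c
  have hD0 : 0 < D := by positivity
  rw [Metric.mem_closure_iff]
  intro ε hε
  obtain ⟨δ, hδ0, hδ⟩ : ∃ δ > 0, |C| * (D * δ) < ε := by
    refine ⟨ε / (|C| * D + 1), by positivity, ?_⟩
    rw [← mul_assoc, mul_div_assoc', div_lt_iff₀ (by positivity)]
    nlinarith
  obtain ⟨a, haJ, ha⟩ := Metric.mem_closure_iff.1
    (hA φ (show ι f x ∈ Iid A φ from (hτ f).symm.trans hf)) δ hδ0
  let K : Set X := {y | δ ≤ ‖ι f y - a‖}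
  have hK : IsCompact K := IsClosed.isCompact
    (isClosed_le continuous_const ((ι f).continuous.sub continuous_const).norm)
  have hxK : scalarEval hι φ x ∉ scalarEval hι φ '' K := by
    rintro ⟨y, hy, hyx⟩
    rw [scalarEval_injective hss hsep hadm hι φ hyx] at hy
    rw [dist_eq_norm] at ha
    exact absurd ha (not_lt.2 hy)
  obtain ⟨u, huJ, hu1, huM⟩ := hM _ (hK.image (continuous_scalarEval hι φ)) hxK
  refine ⟨k a + u * (f - k a), ?_, ?_⟩
  · exact add_mul_mem_Jid (map_mem_Jid k hk (hτk ▸ haJ))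
      (map_mem_Jid (scalarSub X A B ι).val continuous_subtype_val (hτs ▸ huJ)) _
  · rw [dist_eq_norm]
    refine ((hcC _).2.trans ((mul_le_mul_of_nonneg_right (le_abs_self C) (norm_nonneg _)).trans
      (mul_le_mul_of_nonneg_left ?_ (abs_nonneg C)))).trans_lt hδ
    refine (ContinuousMap.norm_le _ (by positivity)).2 fun y => ?_
    have hy : ι (f - (k a + u * (f - k a))) y = (1 - ι (u : B) y) * (ι f y - a) := by
      simp only [map_sub, map_add, map_mul, ContinuousMap.sub_apply, ContinuousMap.add_apply,
        ContinuousMap.mul_apply, hkι]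
      ring
    rw [hy]
    by_cases hyK : y ∈ K
    · have h1 := hu1 _ ⟨y, hyK, rfl⟩
      rw [scalarEval_apply] at h1
      rw [scalar_apply_eq φ u y, h1, map_one, sub_self, zero_mul, norm_zero]
      positivity
    · refine (norm_mul_le _ _).trans (mul_le_mul ?_ (not_le.1 hyK).le (norm_nonneg _) hD0.le)
      refine (norm_sub_le _ _).trans (add_le_add le_rfl ?_)
      refine ((ι (u : B)).norm_coe_le_norm y).trans ?_
      rw [le_div_iff₀ hc, mul_comm]
      exact (hcC u).1.trans huM

end VectorValued

end VV

theorem stronglyRegular_iff_of_uniform_bru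
    (X : Type*) [TopologicalSpace X] [CompactSpace X] [T2Space X]
    (A : Type*) [NormedCommRing A] [NormedAlgebra ℂ A] [CompleteSpace A] [Nontrivial A]
    (hss : VV.IsSemisimple A)
    (B : Type*) [NormedCommRing B] [NormedAlgebra ℂ B] [CompleteSpace B] [Nontrivial B]
    (ι : B →ₐ[ℂ] C(X, A)) (hinj : Function.Injective ι)
    (hconst : VV.ContainsConstants X A B ι) (hsep : VV.Separates X A B ι)
    (hadm : VV.Admissible X A B ι) (hnat : VV.NaturalProduct X A B ι)
    (hunif : VV.IsUniform X A B ι)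
    (hbru : VV.HasBRU (VV.scalarSub X A B ι)) :
    VV.IsStronglyRegular B ↔ VV.IsStronglyRegular A := by
  exact ⟨VV.IsStronglyRegular.of_vectorValued hinj hconst hunif,
    VV.IsStronglyRegular.vectorValued hss hinj hconst hsep hadm hnat hunif hbru⟩
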